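/- (Verblunsky's theorem.) For every sequence (α_j)_{j=0}^∞ with α_j ∈ 𝔻 for all j, there exists one and only one nontrivial probability measure μ on the unit circle whose Verblunsky coefficients satisfy α_j(dμ) = α_j for all j. In other words, the map μ ↦ (α_j(dμ))_{j=0}^∞ is a bijection from nontrivial probability measures on ∂𝔻 onto 𝔻^∞. -/

import Mathlib

open MeasureTheory Polynomial Filter

noncomputable section

/-- A nontrivial probability measure on the unit circle: a probability measure on `ℂ`
supported on `{z : ‖z‖ = 1}` that is not concentrated on any finite set
(equivalently, its support is infinite). -/
structure IsNontrivialOnCircle (μ : Measure ℂ) : Prop where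
  prob : IsProbabilityMeasure μ
  onCircle : μ {z : ℂ | ‖z‖ = 1}ᶜ = 0
  infiniteSupport : ∀ s : Finset ℂ, μ ((↑s : Set ℂ)ᶜ) ≠ 0

/-- `Φ` is the family of monic orthogonal polynomials for `μ`: each `Φ n` is monic of
degree `n` and orthogonal in `L²(∂𝔻, dμ)` to `z^j` for `j = 0, …, n-1`. -/
def IsMonicOPUC (μ : Measure ℂ) (Φ : ℕ → Polynomial ℂ) : Prop :=
  ∀ n : ℕ, ((Φ n).Monic ∧ (Φ n).natDegree = n) ∧
    ∀ j < n, ∫ z, (starRingEnd ℂ) z ^ j * (Φ n).eval z ∂μ = 0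

/-- Verblunsky coefficients: `α n = -conj (Φ (n+1) (0))`. -/
def verblunsky (Φ : ℕ → Polynomial ℂ) (n : ℕ) : ℂ :=
  - (starRingEnd ℂ) ((Φ (n + 1)).eval 0)

/-- Squared `L²(dμ)` norm of a polynomial. -/
def polyNormSq (μ : Measure ℂ) (P : Polynomial ℂ) : ℝ :=
  ∫ z, ‖P.eval z‖ ^ 2 ∂μ

/-- Orthonormal polynomial: `φ = Φ / ‖Φ‖_{L²(dμ)}`. -/
def orthonormalize (μ : Measure ℂ) (P : Polynomial ℂ) : Polynomial ℂ :=
  Polynomial.C ((Real.sqrt (polyNormSq μ P) : ℂ))⁻¹ * P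

/-- The reversed polynomial `P^{*,n}(z) = z^n conj (P (1/conj z))`. -/
def revStar (n : ℕ) (P : Polynomial ℂ) : Polynomial ℂ :=
  ∑ j ∈ Finset.range (n + 1),
    Polynomial.C ((starRingEnd ℂ) (P.coeff (n - j))) * Polynomial.X ^ j

section Verblunsky

open scoped ComplexConjugate

/-- The sesquilinear form on polynomials with `⟨X ^ j, X ^ k⟩ = c (k - j)`. -/
def toeplitzForm (c : ℤ → ℂ) : ℂ[X] →ₗ⋆[ℂ] ℂ[X] →ₗ[ℂ] ℂ :=
  LinearMap.mk₂'ₛₗ (starRingEnd ℂ) (RingHom.id ℂ)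
    (fun p q => p.sum fun j a => q.sum fun k b => conj a * b * c (k - j))
    (fun p p' q => by
      refine sum_add_index _ _ _ (by simp [Polynomial.sum_def]) fun j a b => ?_
      simp [Polynomial.sum_def, add_mul, Finset.sum_add_distrib])
    (fun a p q => by
      rw [sum_smul_index _ _ _ (by simp [Polynomial.sum_def])]
      simp [Polynomial.sum_def, mul_assoc, Finset.mul_sum])
    (fun p q q' => by
      rw [← Polynomial.sum_add']
      refine congrArg _ (funext fun j => funext fun a => ?_)
      exact sum_add_index _ _ _ (by simp) fun k b b' => by ring)
    (fun a p q => by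
      simp only [Polynomial.sum_def p, RingHom.id_apply, smul_eq_mul, Finset.mul_sum]
      refine Finset.sum_congr rfl fun j _ => ?_
      rw [sum_smul_index _ _ _ (by simp)]
      simp only [Polynomial.sum_def, Finset.mul_sum]
      exact Finset.sum_congr rfl fun k _ => by ring)

lemma toeplitzForm_apply (c : ℤ → ℂ) (p q : ℂ[X]) :
    toeplitzForm c p q = p.sum fun j a => q.sum fun k b => conj a * b * c (k - j) := rfl

lemma toeplitzForm_X_pow (c : ℤ → ℂ) (j k : ℕ) :
    toeplitzForm c (X ^ j) (X ^ k) = c (k - j) := by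
  rw [toeplitzForm_apply, ← monomial_one_right_eq_X_pow, ← monomial_one_right_eq_X_pow,
    sum_monomial_index _ _ (by simp [Polynomial.sum_def]), sum_monomial_index _ _ (by simp)]
  simp

lemma toeplitzForm_left_eq_sum (c : ℤ → ℂ) {p : ℂ[X]} {n : ℕ} (hp : p.natDegree < n) (q : ℂ[X]) :
    toeplitzForm c p q = ∑ j ∈ Finset.range n, conj (p.coeff j) * toeplitzForm c (X ^ j) q := by
  conv_lhs => rw [as_sum_range_C_mul_X_pow' p hp]
  simp [← smul_eq_C_mul]

lemma toeplitzForm_right_eq_sum (c : ℤ → ℂ) (p : ℂ[X]) {q : ℂ[X]} {n : ℕ} (hq : q.natDegree < n) :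
    toeplitzForm c p q = ∑ j ∈ Finset.range n, q.coeff j * toeplitzForm c p (X ^ j) := by
  conv_lhs => rw [as_sum_range_C_mul_X_pow' q hq]
  simp [← smul_eq_C_mul]

lemma toeplitzForm_X_mul (c : ℤ → ℂ) (p q : ℂ[X]) :
    toeplitzForm c (X * p) (X * q) = toeplitzForm c p q := by
  have h (j : ℕ) : toeplitzForm c (X * X ^ j) (X * q) = toeplitzForm c (X ^ j) q := by
    induction q using Polynomial.induction_on' with
    | add p q hp hq => simp [mul_add, hp, hq]
    | monomial k a =>
      rw [← C_mul_X_pow_eq_monomial, mul_left_comm, ← smul_eq_C_mul, ← smul_eq_C_mul, map_smul,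
        map_smul, ← pow_succ', ← pow_succ', toeplitzForm_X_pow, toeplitzForm_X_pow]
      congr 2
      push_cast
      ring
  induction p using Polynomial.induction_on' with
  | add p q hp hq => simp [mul_add, hp, hq]
  | monomial k a =>
    rw [← C_mul_X_pow_eq_monomial, mul_left_comm, ← smul_eq_C_mul, ← smul_eq_C_mul]
    simp [h]

lemma conj_toeplitzForm {c : ℤ → ℂ} (hc : ∀ n, c (-n) = conj (c n)) (p q : ℂ[X]) :
    conj (toeplitzForm c p q) = toeplitzForm c q p := by
  simp only [toeplitzForm_apply, Polynomial.sum_def, map_sum, map_mul, Complex.conj_conj]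
  rw [Finset.sum_comm]
  refine Finset.sum_congr rfl fun j _ => Finset.sum_congr rfl fun k _ => ?_
  rw [← hc, neg_sub]
  ring

lemma coeff_revStar (n : ℕ) (P : ℂ[X]) (i : ℕ) :
    (revStar n P).coeff i = if i ≤ n then conj (P.coeff (n - i)) else 0 := by
  simp [revStar, finsetSum_coeff, coeff_C_mul, coeff_X_pow]

lemma natDegree_revStar_le (n : ℕ) (P : ℂ[X]) : (revStar n P).natDegree ≤ n := by
  rw [natDegree_le_iff_coeff_eq_zero]
  intro i hi
  simp [coeff_revStar, Nat.not_le.2 hi]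

lemma toeplitzForm_X_pow_revStar (c : ℤ → ℂ) {n j : ℕ} (hj : j ≤ n) {P : ℂ[X]}
    (hP : P.natDegree ≤ n) :
    toeplitzForm c (X ^ j) (revStar n P) = toeplitzForm c P (X ^ (n - j)) := by
  rw [toeplitzForm_right_eq_sum c _ (Nat.lt_succ_of_le (natDegree_revStar_le n P)),
    toeplitzForm_left_eq_sum c (Nat.lt_succ_of_le hP), ← Finset.sum_range_reflect]
  refine Finset.sum_congr rfl fun i hi => ?_
  have hi' : i ≤ n := Nat.lt_succ_iff.1 (Finset.mem_range.1 hi)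
  have h : n + 1 - 1 - i = n - i := by omega
  rw [h, coeff_revStar, if_pos (Nat.sub_le n i), Nat.sub_sub_self hi', toeplitzForm_X_pow,
    toeplitzForm_X_pow]
  congr 2
  push_cast [hi', hj]
  ring

/-- The monic polynomials given by the Szegő recursion with Verblunsky coefficients `α`. -/
def szegoPoly (α : ℕ → ℂ) : ℕ → ℂ[X]
  | 0 => 1
  | n + 1 => X * szegoPoly α n - conj (α n) • revStar n (szegoPoly α n)

lemma monic_X_mul_add {P Q : ℂ[X]} {n : ℕ} (hP : P.Monic) (hn : P.natDegree = n)
    (hQ : Q.natDegree ≤ n) : (X * P + Q).Monic ∧ (X * P + Q).natDegree = n + 1 := by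
  have h1 : (X * P).natDegree = n + 1 := by rw [natDegree_X_mul hP.ne_zero, hn]
  have h2 : Q.natDegree < (X * P).natDegree := by omega
  refine ⟨(monic_X.mul hP).add_of_left (degree_lt_degree h2), ?_⟩
  rw [natDegree_add_eq_left_of_natDegree_lt h2, h1]

lemma szegoPoly_monic_natDegree (α : ℕ → ℂ) (n : ℕ) :
    (szegoPoly α n).Monic ∧ (szegoPoly α n).natDegree = n := by
  induction n with
  | zero => simp [szegoPoly]
  | succ n ih =>
    rw [szegoPoly, sub_eq_add_neg]
    refine monic_X_mul_add ih.1 ih.2 ?_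
    rw [natDegree_neg]
    exact (natDegree_smul_le _ _).trans (natDegree_revStar_le _ _)

lemma coeff_zero_revStar {n : ℕ} {P : ℂ[X]} (hP : P.Monic) (hn : P.natDegree = n) :
    (revStar n P).coeff 0 = 1 := by
  rw [coeff_revStar, if_pos (Nat.zero_le n), Nat.sub_zero, ← hn, hP.coeff_natDegree, map_one]

lemma verblunsky_szegoPoly (α : ℕ → ℂ) (n : ℕ) : verblunsky (szegoPoly α) n = α n := by
  have h := szegoPoly_monic_natDegree α n
  rw [verblunsky, szegoPoly, ← coeff_zero_eq_eval_zero]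
  simp [coeff_zero_revStar h.1 h.2]

/-- The nonnegative moments determined by requiring that `szegoPoly α n` has mean zero
for `n ≥ 1`. -/
def szegoMoment (α : ℕ → ℂ) : ℕ → ℂ
  | 0 => 1
  | n + 1 => -∑ j : Fin (n + 1), (szegoPoly α (n + 1)).coeff j * szegoMoment α j

/-- The extension of `szegoMoment` to a Hermitian sequence on `ℤ`. -/
def szegoMomentInt (α : ℕ → ℂ) : ℤ → ℂ
  | Int.ofNat n => szegoMoment α n
  | Int.negSucc n => conj (szegoMoment α (n + 1))

lemma szegoMomentInt_zero (α : ℕ → ℂ) : szegoMomentInt α 0 = 1 := by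
  change szegoMoment α 0 = 1
  rw [szegoMoment]

lemma szegoMomentInt_neg (α : ℕ → ℂ) (n : ℤ) :
    szegoMomentInt α (-n) = conj (szegoMomentInt α n) := by
  obtain n | n := n
  · cases n with
    | zero => simp [szegoMomentInt_zero]
    | succ n => rfl
  · change szegoMoment α (n + 1) = conj (conj (szegoMoment α (n + 1)))
    simp

lemma toeplitzForm_one_monic (c : ℤ → ℂ) {P : ℂ[X]} {n : ℕ} (hP : P.Monic)
    (hn : P.natDegree = n) :
    toeplitzForm c 1 P = ∑ j ∈ Finset.range n, P.coeff j * c j + c n := by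
  have h (k : ℕ) : toeplitzForm c 1 (X ^ k) = c k := by
    simpa using toeplitzForm_X_pow c 0 k
  rw [toeplitzForm_right_eq_sum c _ (Nat.lt_succ_of_le hn.le), Finset.sum_range_succ]
  simp only [h]
  rw [← hn, hP.coeff_natDegree, one_mul]

lemma toeplitzForm_one_szegoPoly_succ (α : ℕ → ℂ) (n : ℕ) :
    toeplitzForm (szegoMomentInt α) 1 (szegoPoly α (n + 1)) = 0 := by
  have h := szegoPoly_monic_natDegree α (n + 1)
  rw [toeplitzForm_one_monic _ h.1 h.2]
  change _ + szegoMoment α (n + 1) = 0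
  rw [szegoMoment, ← Fin.sum_univ_eq_sum_range
    (fun j => (szegoPoly α (n + 1)).coeff j * szegoMomentInt α j)]
  exact add_neg_cancel _

lemma toeplitzForm_X_pow_szegoPoly (α : ℕ → ℂ) (n j : ℕ) (hj : j < n) :
    toeplitzForm (szegoMomentInt α) (X ^ j) (szegoPoly α n) = 0 := by
  induction n generalizing j with
  | zero => omega
  | succ n ih =>
    cases j with
    | zero => simpa using toeplitzForm_one_szegoPoly_succ α n
    | succ j =>
      have hd := (szegoPoly_monic_natDegree α n).2.le
      rw [szegoPoly, map_sub, map_smul, pow_succ', toeplitzForm_X_mul, ← pow_succ',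
        toeplitzForm_X_pow_revStar _ (by omega) hd,
        ← conj_toeplitzForm (szegoMomentInt_neg α) (X ^ (n - (j + 1))),
        ih _ (by omega), ih _ (by omega)]
      simp

lemma toeplitzForm_eq_zero_of_natDegree_lt {c : ℤ → ℂ} {P Q : ℂ[X]} {n : ℕ}
    (hP : P.natDegree < n) (hQ : ∀ j < n, toeplitzForm c (X ^ j) Q = 0) :
    toeplitzForm c P Q = 0 := by
  rw [toeplitzForm_left_eq_sum c hP]
  exact Finset.sum_eq_zero fun j hj => by rw [hQ j (Finset.mem_range.1 hj), mul_zero]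

/-- The form is positive definite. -/
def IsPosDefToeplitz (c : ℤ → ℂ) : Prop := ∀ p : ℂ[X], p ≠ 0 → 0 < (toeplitzForm c p p).re

lemma toeplitzForm_revStar_self {c : ℤ → ℂ} (hc : ∀ n, c (-n) = conj (c n)) {P : ℂ[X]} {n : ℕ}
    (hP : P.Monic) (hn : P.natDegree = n) (ho : ∀ j < n, toeplitzForm c (X ^ j) P = 0) :
    toeplitzForm c (revStar n P) (revStar n P) = toeplitzForm c P P := by
  have h : toeplitzForm c P P = toeplitzForm c (X ^ n) P := by
    rw [toeplitzForm_left_eq_sum c (Nat.lt_succ_of_le hn.le) P, Finset.sum_range_succ,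
      Finset.sum_eq_zero fun j hj => by rw [ho j (Finset.mem_range.1 hj), mul_zero],
      show P.coeff n = 1 by rw [← hn, hP.coeff_natDegree], map_one, one_mul, zero_add]
  rw [toeplitzForm_left_eq_sum c (Nat.lt_succ_of_le (natDegree_revStar_le n P)),
    Finset.sum_range_succ', Finset.sum_eq_zero, coeff_zero_revStar hP hn,
    toeplitzForm_X_pow_revStar c (Nat.zero_le n) hn.le, Nat.sub_zero,
    ← conj_toeplitzForm hc, ← h, conj_toeplitzForm hc]
  · simp
  · intro j hj
    have := Finset.mem_range.1 hj
    rw [toeplitzForm_X_pow_revStar c (by omega) hn.le, ← conj_toeplitzForm hc, ho _ (by omega)]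
    simp

lemma toeplitzForm_szegoPoly_pos {α : ℕ → ℂ} (hα : ∀ j, ‖α j‖ < 1) (n : ℕ) :
    0 < (toeplitzForm (szegoMomentInt α) (szegoPoly α n) (szegoPoly α n)).re := by
  set c := szegoMomentInt α with hc
  have hH := szegoMomentInt_neg α
  induction n with
  | zero =>
    have := toeplitzForm_X_pow c 0 0
    simp [hc, szegoMomentInt_zero] at this
    simp [szegoPoly, hc, this]
  | succ n ih =>
    set P := szegoPoly α n with hP
    set R := szegoPoly α (n + 1) with hR
    have hd := szegoPoly_monic_natDegree α n
    have hX : X * P = R + conj (α n) • revStar n P := by rw [hR, szegoPoly]; ring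
    have h1 : toeplitzForm c (revStar n P) R = 0 :=
      toeplitzForm_eq_zero_of_natDegree_lt (Nat.lt_succ_of_le (natDegree_revStar_le n P))
        (toeplitzForm_X_pow_szegoPoly α (n + 1))
    have h2 : toeplitzForm c R (revStar n P) = 0 := by
      rw [← conj_toeplitzForm hH, h1, map_zero]
    have h3 := toeplitzForm_revStar_self hH hd.1 hd.2 (toeplitzForm_X_pow_szegoPoly α n)
    have h4 := toeplitzForm_X_mul c P P
    rw [hX] at h4
    simp only [map_add, LinearMap.add_apply, map_smul, LinearMap.map_smulₛₗ, LinearMap.smul_apply,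
      h1, h2, mul_zero, add_zero, zero_add, Complex.conj_conj, smul_eq_mul] at h4
    rw [← hc, ← hP] at h3
    rw [h3, ← mul_assoc, mul_comm (conj _), Complex.mul_conj, Complex.normSq_eq_norm_sq] at h4
    have h5 := congrArg Complex.re h4
    rw [Complex.add_re, Complex.re_ofReal_mul] at h5
    have h6 : ‖α n‖ ^ 2 < 1 := by
      have := hα n
      have := norm_nonneg (α n)
      nlinarith
    nlinarith

lemma isPosDefToeplitz_szegoMomentInt {α : ℕ → ℂ} (hα : ∀ j, ‖α j‖ < 1) :
    IsPosDefToeplitz (szegoMomentInt α) := by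
  have hH := szegoMomentInt_neg α
  have key (n : ℕ) : ∀ p : ℂ[X], p.degree < n → p ≠ 0 →
      0 < (toeplitzForm (szegoMomentInt α) p p).re := by
    induction n with
    | zero =>
      intro p hp h0
      exact absurd (degree_eq_bot.1 (by simpa using hp)) h0
    | succ n ih =>
      intro p hp h0
      set P := szegoPoly α n with hP
      have hd := szegoPoly_monic_natDegree α n
      set a := p.coeff n with ha
      set q := p - a • P with hq
      have hqd : q.degree < n := by
        rw [degree_lt_iff_coeff_zero]
        intro m hm
        rcases hm.eq_or_lt with rfl | hm
        · have : P.coeff n = 1 := by rw [hP, ← hd.1.coeff_natDegree, hd.2]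
          simp [hq, this, ha]
        · have h1 : p.coeff m = 0 := by
            rw [degree_lt_iff_coeff_zero] at hp
            exact hp m hm
          have h2 : P.coeff m = 0 := coeff_eq_zero_of_natDegree_lt (by rw [hd.2]; exact hm)
          simp [hq, h1, h2]
      have h1 : toeplitzForm (szegoMomentInt α) q P = 0 := by
        by_cases hq0 : q = 0
        · simp [hq0]
        · exact toeplitzForm_eq_zero_of_natDegree_lt ((natDegree_lt_iff_degree_lt hq0).2 hqd)
            (toeplitzForm_X_pow_szegoPoly α n)
      have h2 : toeplitzForm (szegoMomentInt α) P q = 0 := by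
        rw [← conj_toeplitzForm hH, h1, map_zero]
      have hpq : p = q + a • P := by simp [hq]
      have h3 : toeplitzForm (szegoMomentInt α) p p = toeplitzForm (szegoMomentInt α) q q +
          ((‖a‖ ^ 2 : ℝ) : ℂ) * toeplitzForm (szegoMomentInt α) P P := by
        conv_lhs => rw [hpq]
        rw [← Complex.normSq_eq_norm_sq, ← Complex.mul_conj]
        simp only [map_add, LinearMap.add_apply, map_smul, LinearMap.map_smulₛₗ,
          LinearMap.smul_apply, h1, h2, smul_eq_mul]
        ring
      rw [h3, Complex.add_re, Complex.re_ofReal_mul]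
      have hPp := toeplitzForm_szegoPoly_pos hα n
      by_cases hq0 : q = 0
      · have : a ≠ 0 := by
          rintro h
          exact h0 (by rw [hpq, hq0, h]; simp)
        simp only [hq0, map_zero, Complex.zero_re, zero_add]
        positivity
      · have := ih q hqd hq0
        positivity
  intro p hp
  exact key (p.natDegree + 1) p
    (degree_le_natDegree.trans_lt (by exact_mod_cast Nat.lt_succ_self _)) hp

lemma eq_zero_of_toeplitzForm_eq_zero {c : ℤ → ℂ} (hc : IsPosDefToeplitz c) {p : ℂ[X]} {n : ℕ}
    (hp : p.degree < n) (ho : ∀ j < n, toeplitzForm c (X ^ j) p = 0) : p = 0 := by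
  by_contra h
  have := hc p h
  rw [toeplitzForm_eq_zero_of_natDegree_lt ((natDegree_lt_iff_degree_lt h).2 hp) ho] at this
  simp at this

/-- Monic orthogonal polynomials with respect to the form attached to `c`. -/
def IsMonicOrthogonal (c : ℤ → ℂ) (Φ : ℕ → ℂ[X]) : Prop :=
  ∀ n, ((Φ n).Monic ∧ (Φ n).natDegree = n) ∧ ∀ j < n, toeplitzForm c (X ^ j) (Φ n) = 0

lemma isMonicOrthogonal_szegoPoly (α : ℕ → ℂ) :
    IsMonicOrthogonal (szegoMomentInt α) (szegoPoly α) :=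
  fun n => ⟨szegoPoly_monic_natDegree α n, toeplitzForm_X_pow_szegoPoly α n⟩

lemma degree_sub_lt_of_monic {P Q : ℂ[X]} {n : ℕ} (hP : P.Monic ∧ P.natDegree = n)
    (hQ : Q.Monic ∧ Q.natDegree = n) : (P - Q).degree < n := by
  have h : P.degree = n := by rw [degree_eq_natDegree hP.1.ne_zero, hP.2]
  have h' : Q.degree = n := by rw [degree_eq_natDegree hQ.1.ne_zero, hQ.2]
  rw [← h]
  exact degree_sub_lt_left (h.trans h'.symm) hP.1.ne_zero (hP.1.trans hQ.1.symm)

lemma IsMonicOrthogonal.unique {c : ℤ → ℂ} (hc : IsPosDefToeplitz c) {Φ Ψ : ℕ → ℂ[X]}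
    (hΦ : IsMonicOrthogonal c Φ) (hΨ : IsMonicOrthogonal c Ψ) : Φ = Ψ := by
  funext n
  refine sub_eq_zero.1 (eq_zero_of_toeplitzForm_eq_zero hc
    (degree_sub_lt_of_monic (hΦ n).1 (hΨ n).1) fun j hj => ?_)
  rw [map_sub, (hΦ n).2 j hj, (hΨ n).2 j hj, sub_zero]

/-- Monic orthogonal polynomials obey the Szegő recursion. -/
lemma IsMonicOrthogonal.eq_szegoPoly {c : ℤ → ℂ} (hH : ∀ n, c (-n) = conj (c n))
    (hc : IsPosDefToeplitz c) {Φ : ℕ → ℂ[X]} (hΦ : IsMonicOrthogonal c Φ) {α : ℕ → ℂ}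
    (hα : ∀ j, verblunsky Φ j = α j) (n : ℕ) : Φ n = szegoPoly α n := by
  induction n with
  | zero =>
    rw [szegoPoly]
    exact (hΦ 0).1.1.natDegree_eq_zero.1 (hΦ 0).1.2
  | succ n ih =>
    rw [szegoPoly, ← ih]
    set R := X * Φ n - conj (α n) • revStar n (Φ n) with hR
    have hm := (hΦ n).1
    have hRm : R.Monic ∧ R.natDegree = n + 1 := by
      rw [hR, sub_eq_add_neg]
      refine monic_X_mul_add hm.1 hm.2 ?_
      rw [natDegree_neg]
      exact (natDegree_smul_le _ _).trans (natDegree_revStar_le _ _)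
    have hdeg := degree_sub_lt_of_monic (hΦ (n + 1)).1 hRm
    have h0 : (Φ (n + 1) - R).coeff 0 = 0 := by
      have h1 : (Φ (n + 1)).coeff 0 = - conj (α n) := by
        rw [← hα n, verblunsky, coeff_zero_eq_eval_zero]
        simp
      simp [hR, h1, coeff_zero_revStar hm.1 hm.2]
    obtain ⟨F, hF⟩ := X_dvd_iff.2 h0
    have ho : ∀ j < n, toeplitzForm c (X ^ j) F = 0 := by
      intro j hj
      rw [← toeplitzForm_X_mul, ← hF, ← pow_succ', map_sub, (hΦ (n + 1)).2 _ (by omega), hR,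
        map_sub, map_smul, pow_succ', toeplitzForm_X_mul, ← pow_succ',
        toeplitzForm_X_pow_revStar _ (by omega) hm.2.le, ← conj_toeplitzForm hH (X ^ (n - (j + 1))),
        (hΦ n).2 _ (by omega), (hΦ n).2 _ (by omega)]
      simp
    have hFd : F.degree < n := by
      rw [degree_lt_iff_coeff_zero] at hdeg ⊢
      intro m hm
      rw [← coeff_X_mul, ← hF]
      exact hdeg _ (by omega)
    rw [eq_zero_of_toeplitzForm_eq_zero hc hFd ho, mul_zero] at hF
    exact sub_eq_zero.1 hF

/-- The Verblunsky coefficients determine the moments. -/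
lemma IsMonicOrthogonal.moment_eq {c c' : ℤ → ℂ} {Φ : ℕ → ℂ[X]} (hΦ : IsMonicOrthogonal c Φ)
    (hΦ' : IsMonicOrthogonal c' Φ) (h0 : c 0 = c' 0) (n : ℕ) : c n = c' n := by
  induction n using Nat.strong_induction_on with
  | _ n ih =>
    rcases Nat.eq_zero_or_pos n with rfl | hn
    · exact h0
    · have h1 := (hΦ n).2 0 hn
      have h2 := (hΦ' n).2 0 hn
      rw [pow_zero, toeplitzForm_one_monic _ (hΦ n).1.1 (hΦ n).1.2] at h1 h2
      rw [Finset.sum_congr rfl fun j hj => by rw [ih j (Finset.mem_range.1 hj)]] at h1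
      exact add_left_cancel (h1.trans h2.symm)

section Herglotz

open scoped ComplexOrder

/-- The Fejér means of the trigonometric series with coefficients `c`. -/
def fejerMean (T : ℝ) (c : ℤ → ℂ) (N : ℕ) (x : AddCircle T) : ℂ :=
  (N + 1 : ℂ)⁻¹ * ∑ j ∈ Finset.range (N + 1), ∑ k ∈ Finset.range (N + 1),
    c (k - j) * fourier ((j : ℤ) - k) x

lemma fejerMean_eq_toeplitzForm {T : ℝ} (c : ℤ → ℂ) (N : ℕ) (x : AddCircle T) :
    fejerMean T c N x = (N + 1 : ℂ)⁻¹ *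
      toeplitzForm c (∑ j ∈ Finset.range (N + 1), (fourier (-(j : ℤ)) x : ℂ) • X ^ j)
        (∑ j ∈ Finset.range (N + 1), (fourier (-(j : ℤ)) x : ℂ) • X ^ j) := by
  rw [fejerMean]
  congr 1
  simp only [map_sum, LinearMap.sum_apply, map_smul, LinearMap.map_smulₛₗ, LinearMap.smul_apply,
    toeplitzForm_X_pow, smul_eq_mul, Finset.mul_sum]
  rw [Finset.sum_comm]
  refine Finset.sum_congr rfl fun k _ => Finset.sum_congr rfl fun j _ => ?_
  rw [← fourier_neg, neg_neg, sub_eq_add_neg (j : ℤ), fourier_add]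
  ring

lemma fejerMean_nonneg {T : ℝ} {c : ℤ → ℂ} (hH : ∀ n, c (-n) = conj (c n))
    (hc : ∀ p, 0 ≤ (toeplitzForm c p p).re) (N : ℕ) (x : AddCircle T) :
    0 ≤ fejerMean T c N x := by
  rw [fejerMean_eq_toeplitzForm]
  have h1 : (0 : ℂ) ≤ (N + 1 : ℂ)⁻¹ := by
    rw [inv_nonneg]
    exact_mod_cast Nat.zero_le (N + 1)
  refine mul_nonneg h1 ?_
  rw [Complex.nonneg_iff]
  exact ⟨hc _, (Complex.conj_eq_iff_im.1 (conj_toeplitzForm hH _ _)).symm⟩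

lemma continuous_fejerMean {T : ℝ} (c : ℤ → ℂ) (N : ℕ) : Continuous (fejerMean T c N) := by
  unfold fejerMean
  fun_prop

variable {T : ℝ} [hT : Fact (0 < T)]

lemma integral_fourier (n : ℤ) :
    ∫ x : AddCircle T, (fourier n x : ℂ) ∂AddCircle.haarAddCircle = if n = 0 then 1 else 0 := by
  have h := congrFun (fourierCoeff_fourier (T := T) n) 0
  simp only [fourierCoeff, neg_zero, fourier_zero, one_smul] at h
  rw [h]
  simp [Pi.single_apply, eq_comm]

lemma integral_fejerMean_mul_fourier (c : ℤ → ℂ) {N n : ℕ} (hn : n ≤ N) :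
    ∫ x, fejerMean T c N x * fourier (n : ℤ) x ∂AddCircle.haarAddCircle =
      (1 - n / (N + 1 : ℂ)) * c n := by
  have hi (m : ℤ) : Integrable (fun x : AddCircle T => (fourier m x : ℂ))
      AddCircle.haarAddCircle :=
    (fourier m).continuous.integrable_of_hasCompactSupport (HasCompactSupport.of_compactSpace _)
  have h1 (x : AddCircle T) : fejerMean T c N x * fourier (n : ℤ) x =
      (N + 1 : ℂ)⁻¹ * ∑ j ∈ Finset.range (N + 1), ∑ k ∈ Finset.range (N + 1),
        c (k - j) * fourier ((j : ℤ) - k + n) x := by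
    simp only [fejerMean, fourier_add, Finset.sum_mul, mul_assoc]
  simp only [h1]
  rw [integral_const_mul, integral_finsetSum]
  swap
  · exact fun j _ => integrable_finsetSum _ fun k _ => (hi _).const_mul _
  have h2 (j : ℕ) : ∫ x : AddCircle T, ∑ k ∈ Finset.range (N + 1),
      c (k - j) * fourier ((j : ℤ) - k + n) x ∂AddCircle.haarAddCircle =
      if j ∈ Finset.range (N + 1 - n) then c n else 0 := by
    rw [integral_finsetSum _ fun k _ => (hi _).const_mul _]
    simp only [integral_const_mul, integral_fourier]
    have h3 (k : ℕ) : c (k - j) * (if (j : ℤ) - k + n = 0 then (1 : ℂ) else 0) =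
        if j + n = k then c n else 0 := by
      by_cases h : j + n = k
      · have : (j : ℤ) - k + n = 0 := by omega
        rw [if_pos this, if_pos h, mul_one]
        congr 1
        omega
      · have : ¬ (j : ℤ) - k + n = 0 := by omega
        rw [if_neg this, if_neg h, mul_zero]
    simp only [h3]
    rw [Finset.sum_ite_eq]
    refine if_congr ?_ rfl rfl
    simp only [Finset.mem_range]
    omega
  simp only [h2]
  rw [← Finset.sum_filter, Finset.filter_mem_eq_inter, Finset.inter_eq_right.2 (by simp),
    Finset.sum_const, Finset.card_range, nsmul_eq_mul, Nat.cast_sub (by omega), ← mul_assoc]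
  have h4 : (N + 1 : ℂ) ≠ 0 := by exact_mod_cast Nat.succ_ne_zero N
  congr 1
  push_cast
  field_simp

lemma exists_measure_fejerMean {c : ℤ → ℂ} (hH : ∀ n, c (-n) = conj (c n)) (h0 : c 0 = 1)
    (hc : ∀ p, 0 ≤ (toeplitzForm c p p).re) (N : ℕ) :
    ∃ μ : ProbabilityMeasure (AddCircle T), ∀ n : ℕ, n ≤ N →
      ∫ x, fourier (n : ℤ) x ∂(μ : Measure (AddCircle T)) = (1 - n / (N + 1 : ℂ)) * c n := by
  have hnn (x : AddCircle T) : 0 ≤ (fejerMean T c N x).re ∧ 0 = (fejerMean T c N x).im :=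
    Complex.nonneg_iff.1 (fejerMean_nonneg hH hc N x)
  have hre (x : AddCircle T) : ((fejerMean T c N x).re : ℂ) = fejerMean T c N x :=
    Complex.ext (by simp) (by simp [← (hnn x).2])
  have hcont : Continuous fun x : AddCircle T => (fejerMean T c N x).re :=
    Complex.continuous_re.comp (continuous_fejerMean c N)
  set μ := (AddCircle.haarAddCircle (T := T)).withDensity
    fun x => ENNReal.ofReal (fejerMean T c N x).re with hμ
  have hint : ∫ x : AddCircle T, (fejerMean T c N x).re ∂AddCircle.haarAddCircle = 1 := by
    have h := integral_fejerMean_mul_fourier (T := T) c (Nat.zero_le N)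
    simp only [Nat.cast_zero, fourier_zero, mul_one, h0, zero_div, sub_zero] at h
    rw [integral_congr_ae (Eventually.of_forall fun x => (hre x).symm),
      integral_complex_ofReal] at h
    exact_mod_cast h
  have hP : IsProbabilityMeasure μ := by
    refine ⟨?_⟩
    rw [hμ, withDensity_apply _ MeasurableSet.univ, Measure.restrict_univ,
      ← ofReal_integral_eq_lintegral_ofReal
        (hcont.integrable_of_hasCompactSupport (HasCompactSupport.of_compactSpace _))
        (Eventually.of_forall fun x => (hnn x).1), hint, ENNReal.ofReal_one]
  refine ⟨⟨μ, hP⟩, fun n hn => ?_⟩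
  rw [← integral_fejerMean_mul_fourier (T := T) c hn]
  change ∫ x, fourier (n : ℤ) x ∂μ = _
  rw [hμ, integral_withDensity_eq_integral_toReal_smul (by fun_prop) (by simp)]
  refine integral_congr_ae (Eventually.of_forall fun x => ?_)
  simp only [ENNReal.toReal_ofReal (hnn x).1, Complex.real_smul, hre]

/-- Herglotz's theorem. -/
lemma exists_measure_fourier_eq {c : ℤ → ℂ} (hH : ∀ n, c (-n) = conj (c n)) (h0 : c 0 = 1)
    (hc : ∀ p, 0 ≤ (toeplitzForm c p p).re) :
    ∃ μ : ProbabilityMeasure (AddCircle T), ∀ n : ℕ,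
      ∫ x, fourier (n : ℤ) x ∂(μ : Measure (AddCircle T)) = c n := by
  choose μ hμ using exists_measure_fejerMean (T := T) hH h0 hc
  obtain ⟨ν, hν⟩ := exists_clusterPt_of_compactSpace (map μ atTop)
  obtain ⟨U, hU, hUν⟩ := mapClusterPt_iff_ultrafilter.1 hν
  refine ⟨ν, fun n => ?_⟩
  have h1 := (ProbabilityMeasure.tendsto_iff_forall_integral_rclike_tendsto ℂ).1 hUν
    (BoundedContinuousFunction.mkOfCompact (fourier (n : ℤ)))
  simp only [BoundedContinuousFunction.mkOfCompact_apply] at h1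
  have h2 : Tendsto (fun N : ℕ => (1 - n / (N + 1 : ℂ)) * c n) atTop (nhds ((1 - 0) * c n)) := by
    refine (Tendsto.const_sub _ ?_).mul_const _
    have := (tendsto_const_div_atTop_nhds_zero_nat (n : ℂ)).comp (tendsto_add_atTop_nat 1)
    simpa [Function.comp_def] using this
  rw [sub_zero, one_mul] at h2
  refine tendsto_nhds_unique h1 ((h2.mono_left hU).congr' ?_)
  filter_upwards [hU (eventually_ge_atTop n)] with N hN
  exact (hμ N n hN).symm

lemma measure_ext_of_fourier {μ ν : Measure (AddCircle T)} [IsFiniteMeasure μ] [IsFiniteMeasure ν]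
    (h : ∀ n : ℕ, ∫ x, fourier (n : ℤ) x ∂μ = ∫ x, fourier (n : ℤ) x ∂ν) : μ = ν := by
  have hi (ρ : Measure (AddCircle T)) [IsFiniteMeasure ρ] (f : C(AddCircle T, ℂ)) :
      Integrable f ρ :=
    f.continuous.integrable_of_hasCompactSupport (HasCompactSupport.of_compactSpace _)
  have hZ (n : ℤ) : ∫ x, fourier n x ∂μ = ∫ x, fourier n x ∂ν := by
    obtain ⟨m, rfl | rfl⟩ := n.eq_nat_or_neg
    · exact h m
    · simp only [fourier_neg, integral_conj, h m]
  have hcl (ρ : Measure (AddCircle T)) [IsFiniteMeasure ρ] :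
      Continuous fun f : C(AddCircle T, ℂ) => ∫ x, f x ∂ρ := by
    refine (continuous_integral.comp (ContinuousMap.toLp (E := ℂ) 1 ρ ℂ).continuous).congr
      fun f => ?_
    exact integral_congr_ae (ContinuousMap.coeFn_toLp ρ f)
  have hall (f : C(AddCircle T, ℂ)) : ∫ x, f x ∂μ = ∫ x, f x ∂ν := by
    have hf : f ∈ closure
        (Submodule.span ℂ (Set.range (fourier (T := T))) : Set C(AddCircle T, ℂ)) := by
      rw [← Submodule.topologicalClosure_coe, span_fourier_closure_eq_top]
      trivial
    refine closure_minimal (t := {f : C(AddCircle T, ℂ) | ∫ x, f x ∂μ = ∫ x, f x ∂ν}) ?_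
      (isClosed_eq (hcl μ) (hcl ν)) hf
    intro g hg
    induction hg using Submodule.span_induction with
    | mem g hg => obtain ⟨n, rfl⟩ := hg; exact hZ n
    | zero => simp
    | add f g _ _ hf hg =>
      simp only [Set.mem_ofPred_eq, ContinuousMap.add_apply] at hf hg ⊢
      rw [integral_add (hi μ f) (hi μ g), integral_add (hi ν f) (hi ν g), hf, hg]
    | smul a g _ hg =>
      simp only [Set.mem_ofPred_eq, ContinuousMap.smul_apply, integral_smul] at hg ⊢
      rw [hg]
  refine ext_of_forall_integral_eq_of_IsFiniteMeasure fun f => ?_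
  have := hall ⟨fun x => (f x : ℂ), by fun_prop⟩
  simp only [ContinuousMap.coe_mk, integral_complex_ofReal] at this
  exact_mod_cast this

end Herglotz

section Circle

/-- A point of the unit circle as an element of `ℝ / (2 * π) ℤ`. -/
def circleAngle (z : ℂ) : AddCircle (2 * Real.pi) := (z.arg : ℝ)

/-- The standard parametrization of the unit circle by `ℝ / (2 * π) ℤ`. -/
def circlePoint (x : AddCircle (2 * Real.pi)) : ℂ := AddCircle.toCircle x

lemma measurable_circleAngle : Measurable circleAngle :=
  (AddCircle.continuous_mk' _).measurable.comp Complex.measurable_arg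

lemma continuous_circlePoint : Continuous circlePoint :=
  continuous_subtype_val.comp AddCircle.continuous_toCircle

lemma norm_circlePoint (x : AddCircle (2 * Real.pi)) : ‖circlePoint x‖ = 1 := Circle.norm_coe _

lemma circlePoint_circleAngle {z : ℂ} (hz : ‖z‖ = 1) : circlePoint (circleAngle z) = z := by
  have h := Complex.norm_mul_exp_arg_mul_I z
  rw [hz, Complex.ofReal_one, one_mul] at h
  rw [circlePoint, circleAngle, AddCircle.toCircle_apply_mk, div_self Real.two_pi_pos.ne', one_mul,
    Circle.coe_exp, h]

lemma fourier_eq_circlePoint_pow (n : ℕ) (x : AddCircle (2 * Real.pi)) :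
    fourier (n : ℤ) x = circlePoint x ^ n := by
  rw [fourier_apply, circlePoint, natCast_zsmul, AddCircle.toCircle_nsmul, Circle.coe_pow]

/-- The trigonometric moments of a measure. -/
def circleMoment (μ : Measure ℂ) (n : ℤ) : ℂ := ∫ z, z ^ n ∂μ

variable {μ : Measure ℂ}

lemma ae_norm_eq_one (h : μ {z : ℂ | ‖z‖ = 1}ᶜ = 0) : ∀ᵐ z ∂μ, ‖z‖ = 1 := h

lemma integrable_of_continuous [IsFiniteMeasure μ] (h : ∀ᵐ z ∂μ, ‖z‖ = 1) {f : ℂ → ℂ}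
    (hf : Continuous f) : Integrable f μ := by
  have h1 := hf.continuousOn.integrableOn_compact (μ := μ) (isCompact_sphere (0 : ℂ) 1)
  rwa [IntegrableOn, Measure.restrict_eq_self_of_ae_mem] at h1
  filter_upwards [h] with z hz
  simpa using hz

lemma circleMoment_neg (h : ∀ᵐ z ∂μ, ‖z‖ = 1) (n : ℤ) :
    circleMoment μ (-n) = conj (circleMoment μ n) := by
  rw [circleMoment, circleMoment, ← integral_conj]
  refine integral_congr_ae ?_
  filter_upwards [h] with z hz
  rw [map_zpow₀, ← Complex.inv_eq_conj hz, inv_zpow, zpow_neg]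

lemma circleMoment_zero [IsProbabilityMeasure μ] : circleMoment μ 0 = 1 := by
  simp [circleMoment]

lemma toeplitzForm_circleMoment [IsFiniteMeasure μ] (h : ∀ᵐ z ∂μ, ‖z‖ = 1) (p q : ℂ[X]) :
    toeplitzForm (circleMoment μ) p q = ∫ z, conj (p.eval z) * q.eval z ∂μ := by
  have h1 (z : ℂ) : conj (p.eval z) * q.eval z = ∑ j ∈ p.support, ∑ k ∈ q.support,
      conj (p.coeff j) * q.coeff k * (conj z ^ j * z ^ k) := by
    simp only [eval_eq_sum, Polynomial.sum_def, map_sum, map_mul, map_pow, Finset.sum_mul_sum]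
    exact Finset.sum_congr rfl fun j _ => Finset.sum_congr rfl fun k _ => by ring
  simp only [h1]
  rw [integral_finsetSum _ fun j _ => integrable_of_continuous h (by fun_prop),
    toeplitzForm_apply, Polynomial.sum_def]
  refine Finset.sum_congr rfl fun j _ => ?_
  rw [integral_finsetSum _ fun k _ => integrable_of_continuous h (by fun_prop),
    Polynomial.sum_def]
  refine Finset.sum_congr rfl fun k _ => ?_
  rw [integral_const_mul, circleMoment]
  congr 1
  refine integral_congr_ae ?_
  filter_upwards [h] with z hz
  have hz0 : z ≠ 0 := by rintro rfl; simp at hz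
  rw [← Complex.inv_eq_conj hz, sub_eq_neg_add, zpow_add₀ hz0, zpow_neg, zpow_natCast,
    zpow_natCast, inv_pow]

lemma re_toeplitzForm_circleMoment_self [IsFiniteMeasure μ] (h : ∀ᵐ z ∂μ, ‖z‖ = 1) (p : ℂ[X]) :
    (toeplitzForm (circleMoment μ) p p).re = ∫ z, ‖p.eval z‖ ^ 2 ∂μ := by
  rw [toeplitzForm_circleMoment h]
  simp only [Complex.conj_mul', ← Complex.ofReal_pow]
  rw [integral_complex_ofReal, Complex.ofReal_re]

lemma isMonicOPUC_iff [IsFiniteMeasure μ] (h : ∀ᵐ z ∂μ, ‖z‖ = 1) (Φ : ℕ → ℂ[X]) :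
    IsMonicOPUC μ Φ ↔ IsMonicOrthogonal (circleMoment μ) Φ := by
  simp only [IsMonicOPUC, IsMonicOrthogonal, toeplitzForm_circleMoment h, eval_pow, eval_X, map_pow]

lemma integrable_norm_eval_sq [IsFiniteMeasure μ] (h : ∀ᵐ z ∂μ, ‖z‖ = 1) (p : ℂ[X]) :
    Integrable (fun z => ‖p.eval z‖ ^ 2) μ := by
  have := integrable_of_continuous h (f := fun z => ((‖p.eval z‖ ^ 2 : ℝ) : ℂ)) (by fun_prop)
  exact this.re

lemma isPosDefToeplitz_circleMoment_iff [IsFiniteMeasure μ] (h : ∀ᵐ z ∂μ, ‖z‖ = 1) :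
    IsPosDefToeplitz (circleMoment μ) ↔ ∀ s : Finset ℂ, μ ((↑s : Set ℂ)ᶜ) ≠ 0 := by
  constructor
  · intro hc s hs
    have hp : (∏ a ∈ s, (X - C a)) ≠ 0 :=
      (monic_prod_of_monic _ _ fun a _ => monic_X_sub_C a).ne_zero
    have h1 := hc _ hp
    rw [re_toeplitzForm_circleMoment_self h, integral_eq_zero_of_ae] at h1
    · exact lt_irrefl _ h1
    · have : ∀ᵐ z ∂μ, z ∈ (↑s : Set ℂ) := hs
      filter_upwards [this] with z hz
      simp [eval_prod, Finset.prod_eq_zero (Finset.mem_coe.1 hz) (sub_self z)]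
  · intro hs p hp
    rw [re_toeplitzForm_circleMoment_self h,
      integral_pos_iff_support_of_nonneg (fun z => by positivity) (integrable_norm_eval_sq h p)]
    have : (Function.support fun z => ‖p.eval z‖ ^ 2) = (↑p.roots.toFinset : Set ℂ)ᶜ := by
      ext z
      simp [hp]
    rw [this]
    exact pos_iff_ne_zero.2 (hs _)

lemma measure_ext_of_circleMoment {ν : Measure ℂ} [IsFiniteMeasure μ] [IsFiniteMeasure ν]
    (hμ : ∀ᵐ z ∂μ, ‖z‖ = 1) (hν : ∀ᵐ z ∂ν, ‖z‖ = 1)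
    (h : ∀ n : ℕ, circleMoment μ n = circleMoment ν n) : μ = ν := by
  have : Fact (0 < 2 * Real.pi) := ⟨Real.two_pi_pos⟩
  have hm (ρ : Measure ℂ) (hρ : ∀ᵐ z ∂ρ, ‖z‖ = 1) :
      (ρ.map circleAngle).map circlePoint = ρ := by
    rw [Measure.map_map continuous_circlePoint.measurable measurable_circleAngle]
    conv_rhs => rw [← Measure.map_id (μ := ρ)]
    refine Measure.map_congr ?_
    filter_upwards [hρ] with z hz
    exact circlePoint_circleAngle hz
  have hf (ρ : Measure ℂ) (hρ : ∀ᵐ z ∂ρ, ‖z‖ = 1) (n : ℕ) :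
      ∫ x, fourier (n : ℤ) x ∂(ρ.map circleAngle) = circleMoment ρ n := by
    rw [integral_map measurable_circleAngle.aemeasurable
      (fourier (n : ℤ)).continuous.aestronglyMeasurable, circleMoment]
    refine integral_congr_ae ?_
    filter_upwards [hρ] with z hz
    rw [fourier_eq_circlePoint_pow, circlePoint_circleAngle hz, zpow_natCast]
  rw [← hm μ hμ, ← hm ν hν, measure_ext_of_fourier (μ := μ.map circleAngle)
    (ν := ν.map circleAngle) fun n => by rw [hf μ hμ, hf ν hν, h]]

lemma exists_measure_circleMoment_eq {c : ℤ → ℂ} (hH : ∀ n, c (-n) = conj (c n)) (h0 : c 0 = 1)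
    (hc : ∀ p, 0 ≤ (toeplitzForm c p p).re) :
    ∃ μ : Measure ℂ, IsProbabilityMeasure μ ∧ (∀ᵐ z ∂μ, ‖z‖ = 1) ∧ circleMoment μ = c := by
  have : Fact (0 < 2 * Real.pi) := ⟨Real.two_pi_pos⟩
  obtain ⟨ν, hν⟩ := exists_measure_fourier_eq (T := 2 * Real.pi) hH h0 hc
  have hm := continuous_circlePoint.measurable
  have hae : ∀ᵐ z ∂(ν : Measure _).map circlePoint, ‖z‖ = 1 := by
    rw [ae_map_iff hm.aemeasurable (measurableSet_eq_fun measurable_norm measurable_const)]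
    exact Eventually.of_forall norm_circlePoint
  have hN (n : ℕ) : circleMoment ((ν : Measure _).map circlePoint) n = c n := by
    rw [← hν n, circleMoment]
    simp only [zpow_natCast, fourier_eq_circlePoint_pow]
    exact integral_map hm.aemeasurable (continuous_pow n).aestronglyMeasurable
  refine ⟨(ν : Measure _).map circlePoint, Measure.isProbabilityMeasure_map hm.aemeasurable, hae,
    funext fun n => ?_⟩
  obtain ⟨m, rfl | rfl⟩ := n.eq_nat_or_neg
  · exact hN m
  · rw [circleMoment_neg hae, hH, hN]

end Circle

end Verblunsky

/-- Verblunsky's theorem: for every sequence in `𝔻^∞` there is one and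
only one nontrivial probability measure on the unit circle whose Verblunsky
coefficients are the given sequence. -/
theorem stmt2 (α : ℕ → ℂ) (hα : ∀ j, ‖α j‖ < 1) :
    ∃! μ : Measure ℂ, IsNontrivialOnCircle μ ∧
      (∃ Φ : ℕ → Polynomial ℂ, IsMonicOPUC μ Φ) ∧
      (∀ Φ : ℕ → Polynomial ℂ, IsMonicOPUC μ Φ → ∀ j, verblunsky Φ j = α j) := by
  have hpd := isPosDefToeplitz_szegoMomentInt hα
  obtain ⟨μ, hP, hae, hμ⟩ := exists_measure_circleMoment_eq (szegoMomentInt_neg α)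
    (szegoMomentInt_zero α) fun p => by
      by_cases hp : p = 0
      · simp [hp]
      · exact (hpd p hp).le
  have hS := isMonicOrthogonal_szegoPoly α
  have key (ν : Measure ℂ) (h : IsNontrivialOnCircle ν) (Φ : ℕ → Polynomial ℂ)
      (hΦ : IsMonicOPUC ν Φ) (hv : ∀ j, verblunsky Φ j = α j) :
      IsMonicOrthogonal (circleMoment ν) (szegoPoly α) := by
    have := h.prob
    have hν := ae_norm_eq_one h.onCircle
    rw [isMonicOPUC_iff hν] at hΦ
    rwa [funext (hΦ.eq_szegoPoly (circleMoment_neg hν)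
      ((isPosDefToeplitz_circleMoment_iff hν).2 h.infiniteSupport) hv)] at hΦ
  refine ⟨μ, ⟨⟨hP, hae, ?_⟩, ⟨szegoPoly α, ?_⟩, fun Φ hΦ j => ?_⟩, ?_⟩
  · rwa [← isPosDefToeplitz_circleMoment_iff hae, hμ]
  · rwa [isMonicOPUC_iff hae, hμ]
  · rw [isMonicOPUC_iff hae, hμ] at hΦ
    rw [hΦ.unique hpd hS, verblunsky_szegoPoly]
  · rintro ν ⟨hν, ⟨Φ, hΦ⟩, hv⟩
    have := hν.prob
    refine measure_ext_of_circleMoment (ae_norm_eq_one hν.onCircle) hae fun n => ?_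
    rw [hμ]
    exact (key ν hν Φ hΦ (hv Φ hΦ)).moment_eq hS
      (by rw [circleMoment_zero, szegoMomentInt_zero]) n

end
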